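/- Let n be an even positive integer and let π be any permutation of [n]. Then the map f ↦ h_{π,f} is a bijection from the set of 'yes' instances of UniqueSearch_{n/2} (functions f : [n/2] → {0,1} with exactly one element mapped to 1) onto Q_π. -/

import Mathlib

/- `Fin n` models `[n] = {1, …, n}`: the element `i : Fin n` represents the
integer `i.val + 1`, so `⟨0, hn⟩` represents the element `1`. -/

/-- `P0`: permutations `π` of `[n]` such that `π⁻¹(1)` is odd. -/
def P0 (n : ℕ) (hn : 0 < n) : Finset (Equiv.Perm (Fin n)) :=
  Finset.univ.filter fun π => Odd ((π.symm ⟨0, hn⟩ : Fin n).val + 1)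

/-- `P1`: permutations `π` of `[n]` such that `π⁻¹(1)` is even. -/
def P1 (n : ℕ) (hn : 0 < n) : Finset (Equiv.Perm (Fin n)) :=
  Finset.univ.filter fun π => Even ((π.symm ⟨0, hn⟩ : Fin n).val + 1)

/-- `Q`: functions `h : [n] → [n]` whose preimage of `1` has exactly two
elements, exactly one of which is odd, and such that every value other
than `1` has at most one preimage (a unique collision, at the value `1`,
with one odd and one even element in the colliding pair). -/
def Qset (n : ℕ) (hn : 0 < n) : Finset (Fin n → Fin n) :=
  Finset.univ.filter fun h =>
    (Finset.univ.filter fun i => h i = (⟨0, hn⟩ : Fin n)).card = 2 ∧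
    (Finset.univ.filter fun i => h i = (⟨0, hn⟩ : Fin n) ∧ Odd (i.val + 1)).card = 1 ∧
    ∀ y : Fin n, y ≠ ⟨0, hn⟩ → (Finset.univ.filter fun i => h i = y).card ≤ 1

/-- `Q_π`: functions in `Q` that differ from the permutation `π` in exactly
one point. -/
def Qpi (n : ℕ) (hn : 0 < n) (π : Equiv.Perm (Fin n)) : Finset (Fin n → Fin n) :=
  (Qset n hn).filter fun h => (Finset.univ.filter fun i => h i ≠ π i).card = 1

/-- `h_{π,f}` for a permutation `π` of `[n]` (`n` even) and `f : [n/2] → {0,1}`.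
If `π ∈ P0` (i.e. `π⁻¹(1)` is odd): `h_{π,f}(i) = 1` if `i` is even and
`f(i/2) = 1`, and `h_{π,f}(i) = π(i)` otherwise.  If `π ∈ P1`:
`h_{π,f}(i) = 1` if `i` is odd and `f((i+1)/2) = 1`, and `h_{π,f}(i) = π(i)`
otherwise.  (Recall `i : Fin n` represents the integer `i.val + 1`, so the
element `i/2` of `[n/2]` has index `(i.val+1)/2 - 1`, and `(i+1)/2` has index
`(i.val+2)/2 - 1`.) -/
def hpf (n : ℕ) (hn : 0 < n) (hne : Even n) (π : Equiv.Perm (Fin n))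
    (f : Fin (n / 2) → Fin 2) : Fin n → Fin n := fun i =>
  if Odd ((π.symm ⟨0, hn⟩ : Fin n).val + 1) then
    -- the case π ∈ P0
    if Even (i.val + 1) ∧
        f ⟨(i.val + 1) / 2 - 1, by
          have h1 := i.isLt; have h2 := Nat.even_iff.mp hne; omega⟩ = 1 then
      ⟨0, hn⟩
    else π i
  else
    -- the case π ∈ P1
    if Odd (i.val + 1) ∧
        f ⟨(i.val + 1 + 1) / 2 - 1, by
          have h1 := i.isLt; have h2 := Nat.even_iff.mp hne; omega⟩ = 1 then
      ⟨0, hn⟩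
    else π i

/-- The 'yes' instances of `UniqueSearch_m`: functions `f : [m] → {0,1}`
mapping exactly one element to `1`. -/
def YesInst (m : ℕ) : Finset (Fin m → Fin 2) :=
  Finset.univ.filter fun f => (Finset.univ.filter fun x => f x = 1).card = 1

theorem mem_YesInst_iff {m : ℕ} {f : Fin m → Fin 2} :
    f ∈ YesInst m ↔ ∃ x, f = Pi.single x 1 := by
  simp only [YesInst, Finset.mem_filter, Finset.mem_univ, true_and, Finset.card_eq_one]
  refine exists_congr fun x => ?_
  simp only [Finset.ext_iff, Finset.mem_filter, Finset.mem_univ, true_and, Finset.mem_singleton,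
    funext_iff, Pi.single_apply]
  refine forall_congr' fun i => ?_
  by_cases hi : i = x <;> simp only [hi, iff_true, iff_false, if_true, if_false]
  omega

/-- Replacing the value of `π` at a point `j` by `1` creates the colliding pair `{j, π⁻¹(1)}`. -/
theorem filter_update_eq_pair {α : Type*} [Fintype α] [DecidableEq α] (π : Equiv.Perm α)
    (j z : α) :
    (Finset.univ.filter fun i => Function.update π j z i = z) = {j, π.symm z} := by
  ext i
  by_cases hi : i = j <;> simp [hi, Equiv.eq_symm_apply]

theorem card_filter_odd_pair_eq_one_iff {n : ℕ} {j p : Fin n} :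
    ((({j, p} : Finset (Fin n)).filter fun i => Odd (i.val + 1)).card = 1 ∧ j ≠ p) ↔
      ¬(Odd (j.val + 1) ↔ Odd (p.val + 1)) := by
  by_cases hjp : j = p
  · simp [hjp]
  · by_cases hj : Odd (j.val + 1) <;> by_cases hp : Odd (p.val + 1) <;>
      simp [Finset.filter_insert, Finset.filter_singleton, hj, hp, hjp]

theorem update_mem_Qpi {n : ℕ} (hn : 0 < n) (π : Equiv.Perm (Fin n)) {j : Fin n}
    (hj : ¬(Odd (j.val + 1) ↔ Odd ((π.symm ⟨0, hn⟩ : Fin n).val + 1))) :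
    Function.update π j ⟨0, hn⟩ ∈ Qpi n hn π := by
  obtain ⟨hodd, hne⟩ := card_filter_odd_pair_eq_one_iff.2 hj
  simp only [Qpi, Qset, Finset.mem_filter, Finset.mem_univ, true_and]
  refine ⟨⟨?_, ?_, fun y hy => ?_⟩, Finset.card_eq_one.2 ⟨j, ?_⟩⟩
  · rw [filter_update_eq_pair, Finset.card_pair hne]
  · rw [← Finset.filter_filter, filter_update_eq_pair, hodd]
  · refine Finset.card_le_one.2 fun a ha b hb => ?_
    simp only [Finset.mem_filter, Finset.mem_univ, true_and, Function.update_apply] at ha hb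
    split_ifs at ha hb
    · exact absurd ha.symm hy
    · exact absurd ha.symm hy
    · exact absurd hb.symm hy
    · exact π.injective (ha.trans hb.symm)
  · ext i
    have hz : (⟨0, hn⟩ : Fin n) ≠ π j := fun h => hne (π.eq_symm_apply.2 h.symm)
    by_cases hi : i = j <;> simp [hi, hz]

theorem exists_eq_update_of_mem_Qpi {n : ℕ} {hn : 0 < n} {π : Equiv.Perm (Fin n)}
    {h : Fin n → Fin n} (hh : h ∈ Qpi n hn π) :
    ∃ j : Fin n, ¬(Odd (j.val + 1) ↔ Odd ((π.symm ⟨0, hn⟩ : Fin n).val + 1)) ∧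
      h = Function.update π j ⟨0, hn⟩ := by
  simp only [Qpi, Qset, Finset.mem_filter, Finset.mem_univ, true_and] at hh
  obtain ⟨⟨htwo, hodd, hinj⟩, hdiff⟩ := hh
  obtain ⟨j, hj⟩ := Finset.card_eq_one.1 hdiff
  have hj' : ∀ i, h i ≠ π i ↔ i = j := fun i => by simpa using Finset.ext_iff.1 hj i
  have hv : h j = ⟨0, hn⟩ := by
    by_contra hv
    have hk : π.symm (h j) ≠ j := fun hk =>
      (hj' j).2 rfl (by rw [← π.symm_apply_eq, hk])
    refine hk (Finset.card_le_one.1 (hinj _ hv) _ ?_ _ (by simp))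
    simpa using not_not.1 (mt (hj' _).1 hk)
  have hupd : h = Function.update π j ⟨0, hn⟩ := by
    funext i
    by_cases hi : i = j
    · simp [hi, hv]
    · simpa [hi] using not_not.1 (mt (hj' i).1 hi)
  subst hupd
  refine ⟨j, card_filter_odd_pair_eq_one_iff.1 ⟨?_, ?_⟩, rfl⟩
  · rwa [← Finset.filter_filter, filter_update_eq_pair] at hodd
  · intro hjp
    rw [filter_update_eq_pair, ← hjp] at htwo
    simp at htwo

/-- `h_{π,f}` for the indicator function `f` of `x` is obtained from `π` by changing to `1` its
value at the `x`-th element whose parity is opposite to that of `π⁻¹(1)`. -/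
theorem hpf_single {n : ℕ} {hn : 0 < n} {hne : Even n} {π : Equiv.Perm (Fin n)}
    {x : Fin (n / 2)} {j : Fin n} (hx : x.val = j.val / 2)
    (hj : ¬(Odd (j.val + 1) ↔ Odd ((π.symm ⟨0, hn⟩ : Fin n).val + 1))) :
    hpf n hn hne π (Pi.single x 1) = Function.update π j ⟨0, hn⟩ := by
  funext i
  simp only [hpf, Function.update_apply, Pi.single_apply, ite_eq_left_iff, zero_ne_one, imp_false,
    not_not, Fin.ext_iff, hx]
  split_ifs <;> first | rfl | (exfalso; grind)

theorem exists_opposite_parity {n : ℕ} (p : Fin n) (x : Fin (n / 2)) :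
    ∃ j : Fin n, x.val = j.val / 2 ∧ ¬(Odd (j.val + 1) ↔ Odd (p.val + 1)) := by
  have hx := x.isLt
  by_cases hp : Odd (p.val + 1)
  · exact ⟨⟨2 * x.val + 1, by omega⟩, by simp only; omega, by grind⟩
  · exact ⟨⟨2 * x.val, by omega⟩, by simp only; omega, by grind⟩

/-- For an even positive integer `n` and any permutation `π` of `[n]`, the map
`f ↦ h_{π,f}` is a bijection from the set of 'yes' instances of
`UniqueSearch_{n/2}` onto `Q_π`. -/
theorem hpf_bijOn_Yes_Qpi (n : ℕ) (hn : 0 < n) (hne : Even n)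
    (π : Equiv.Perm (Fin n)) :
    Set.BijOn (hpf n hn hne π) (↑(YesInst (n / 2))) (↑(Qpi n hn π)) := by
  refine ⟨fun f hf => ?_, fun f hf g hg hfg => ?_, fun h hh => ?_⟩
  · obtain ⟨x, rfl⟩ := mem_YesInst_iff.1 hf
    obtain ⟨j, hx, hj⟩ := exists_opposite_parity (π.symm ⟨0, hn⟩) x
    rw [hpf_single hx hj]
    exact update_mem_Qpi hn π hj
  · obtain ⟨x, rfl⟩ := mem_YesInst_iff.1 hf
    obtain ⟨y, rfl⟩ := mem_YesInst_iff.1 hg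
    obtain ⟨j, hx, hj⟩ := exists_opposite_parity (π.symm ⟨0, hn⟩) x
    obtain ⟨k, hy, hk⟩ := exists_opposite_parity (π.symm ⟨0, hn⟩) y
    rw [hpf_single hx hj, hpf_single hy hk] at hfg
    have hjk : j = k := by
      by_contra hjk
      have hjz := congrFun hfg j
      rw [Function.update_self, Function.update_of_ne hjk] at hjz
      exact hj (by rw [π.eq_symm_apply.2 hjz.symm])
    rw [Fin.ext (hx.trans (hjk ▸ hy.symm))]
  · obtain ⟨j, hj, rfl⟩ := exists_eq_update_of_mem_Qpi hh
    have hlt : j.val / 2 < n / 2 := by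
      have := j.isLt
      have := Nat.even_iff.1 hne
      omega
    exact ⟨Pi.single ⟨j.val / 2, hlt⟩ 1, mem_YesInst_iff.2 ⟨_, rfl⟩, hpf_single rfl hj⟩
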